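/- Let $R$ be a nonzero rational function with complex coefficients such that every pole of $R$ is real, every zero of $R$ is real, and $R(-\overline{\omega}) = \overline{R(\omega)}$ for every $\omega\in\mathbb{C}$ such that neither $\omega$ nor $-\overline{\omega}$ is a pole of $R$. (Poles and zeros are the roots of the denominator and of the numerator of the reduced representation of $R$.) (a) $R$ is even, i.e. $R(-\omega)=R(\omega)$ as rational functions, if and only if the multiplicity of $0$ as a zero or a pole of $R$ is even (this multiplicity being $0$ if $0$ is neither a zero nor a pole). (b) In particular, $R$ is even whenever it satisfies the high-frequency condition: there is a nonzero $L\in\mathbb{C}$ such that, for every $\eta>0$, $R(\omega)\to L$ as $|\omega|\to\infty$ with $\operatorname{Im}\omega\ge\eta$. -/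

import Mathlib

open Filter Topology

/-- `R(ω)`, the value of the rational function `R` at `ω`, for `ω` not a pole. -/
noncomputable abbrev ratValue (R : RatFunc ℂ) (ω : ℂ) : ℂ :=
  R.eval (RingHom.id ℂ) ω

/-- `ω` is a pole of `R`: a root of the denominator of the reduced representation. -/
def IsRatPole (R : RatFunc ℂ) (ω : ℂ) : Prop := R.denom.IsRoot ω

/-- `ω` is a zero of `R`: a root of the numerator of the reduced representation. -/
def IsRatZero (R : RatFunc ℂ) (ω : ℂ) : Prop := R.num.IsRoot ω

/-- `R` is even: substituting `-X` for the variable gives `R` back, as rational functions. -/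
def RatEven (R : RatFunc ℂ) : Prop := R.eval RatFunc.C (-RatFunc.X) = R

/-- The multiplicity of `ω` as a zero or as a pole of `R` (for nonzero `R` at most one of the two
summands is nonzero, since numerator and denominator are coprime; it is `0` if `ω` is neither). -/
noncomputable def ratMultiplicity (R : RatFunc ℂ) (ω : ℂ) : ℕ :=
  R.num.rootMultiplicity ω + R.denom.rootMultiplicity ω

/-- The high-frequency condition with limit `L`: for every `η > 0`, `R(ω) → L` as `|ω| → ∞` within
the half-plane `Im ω ≥ η`. -/
def HighFrequencyLimit (R : RatFunc ℂ) (L : ℂ) : Prop :=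
  ∀ η : ℝ, 0 < η →
    Tendsto (ratValue R) (Bornology.cobounded ℂ ⊓ 𝓟 {ω : ℂ | η ≤ ω.im}) (𝓝 L)

open Polynomial in
theorem Polynomial.map_conj_of_roots_real {p : ℂ[X]} (h : ∀ z, p.IsRoot z → z.im = 0) :
    C p.leadingCoeff * p.map (starRingEnd ℂ) = C (starRingEnd ℂ p.leadingCoeff) * p := by
  have hp := (IsAlgClosed.splits p).eq_prod_roots
  have hm : p.map (starRingEnd ℂ) =
      C (starRingEnd ℂ p.leadingCoeff) * (p.roots.map (X - C ·)).prod := by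
    conv_lhs => rw [hp]
    rw [Polynomial.map_mul, map_C, Polynomial.map_multiset_prod, Multiset.map_map]
    congr 2
    refine Multiset.map_congr rfl fun z hz => ?_
    have hz' : starRingEnd ℂ z = z := Complex.conj_eq_iff_im.2 (h z (isRoot_of_mem_roots hz))
    simp [hz']
  rw [hm, mul_left_comm, ← hp]

open Polynomial in
theorem Polynomial.comp_neg_X_coeff {R : Type*} [CommRing R] (p : R[X]) (n : ℕ) :
    (p.comp (-X)).coeff n = (-1) ^ n * p.coeff n := by
  have h := comp_C_mul_X_coeff (p := p) (r := (-1 : R)) (n := n)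
  rw [show C (-1 : R) * X = -X by simp] at h
  rw [h, mul_comm]

/-- A polynomial dividing its reflection is an eigenvector of it, with the eigenvalue read off from
the order of vanishing at `0`, and also from the degree. -/
theorem Polynomial.comp_neg_X_of_dvd {K : Type*} [Field K] {p : Polynomial K} (hp : p ≠ 0)
    (h : p ∣ p.comp (-X)) :
    p.comp (-X) = C ((-1) ^ p.rootMultiplicity 0) * p ∧
      (-1 : K) ^ p.natDegree = (-1) ^ p.rootMultiplicity 0 := by
  have ha : Associated p (p.comp (-X)) :=
    associated_of_dvd_of_degree_eq h (by simp)
  obtain ⟨u, hu⟩ := ha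
  obtain ⟨e, -, he⟩ := isUnit_iff.1 u.isUnit
  rw [← he, mul_comm] at hu
  have key (n : ℕ) (hn : p.coeff n ≠ 0) : e = (-1) ^ n := by
    have := congrArg (coeff · n) hu
    simp only [coeff_C_mul, comp_neg_X_coeff] at this
    exact mul_right_cancel₀ hn this
  have h₁ := key p.natDegree (by simpa using hp)
  have h₂ := key (p.rootMultiplicity 0) (by
    rw [rootMultiplicity_eq_natTrailingDegree']
    exact trailingCoeff_nonzero_iff_nonzero.2 hp)
  exact ⟨by rw [← hu, h₂], h₁.symm.trans h₂⟩

theorem Polynomial.natDegree_eq_of_tendsto_div {𝕜 : Type*} [NormedField 𝕜] {p q : Polynomial 𝕜}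
    {l : Filter 𝕜} [l.NeBot] (hl : l ≤ Bornology.cobounded 𝕜) {L : 𝕜} (hL : L ≠ 0)
    (h : Tendsto (fun z => p.eval z / q.eval z) l (𝓝 L)) : p.natDegree = q.natDegree := by
  have h' : Tendsto (fun z => q.eval z / p.eval z) l (𝓝 L⁻¹) := by
    simpa [inv_div] using h.inv₀ hL
  refine natDegree_eq_of_degree_eq (le_antisymm ?_ ?_) <;> by_contra! hlt
  · exact inv_ne_zero hL (tendsto_nhds_unique h'
      ((isLittleO_cobounded_of_degree_lt hlt).mono hl).tendsto_div_nhds_zero)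
  · exact hL (tendsto_nhds_unique h
      ((isLittleO_cobounded_of_degree_lt hlt).mono hl).tendsto_div_nhds_zero)

theorem Complex.cobounded_inf_principal_im_neBot (η : ℝ) :
    (Bornology.cobounded ℂ ⊓ 𝓟 {ω : ℂ | η ≤ ω.im}).NeBot := by
  have h : Tendsto (fun y : ℝ => (y : ℂ) * Complex.I) atTop
      (Bornology.cobounded ℂ ⊓ 𝓟 {ω : ℂ | η ≤ ω.im}) := by
    refine tendsto_inf.2 ⟨?_, tendsto_principal.2 ?_⟩
    · rw [← tendsto_norm_atTop_iff_cobounded]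
      simpa using tendsto_abs_atTop_atTop
    · filter_upwards [eventually_ge_atTop η] with y hy
      simpa using hy
  exact h.neBot

theorem ratEven_iff_comp_neg_X (R : RatFunc ℂ) :
    RatEven R ↔ R.num.comp (-Polynomial.X) * R.denom = R.num * R.denom.comp (-Polynomial.X) := by
  have hev (p : Polynomial ℂ) : p.eval₂ RatFunc.C (-RatFunc.X) =
      algebraMap (Polynomial ℂ) (RatFunc ℂ) (p.comp (-Polynomial.X)) := by
    rw [Polynomial.comp, Polynomial.hom_eval₂]
    congr 1
    simp
  have hne {p : Polynomial ℂ} (hp : p ≠ 0) : algebraMap (Polynomial ℂ) (RatFunc ℂ) p ≠ 0 :=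
    RatFunc.algebraMap_ne_zero hp
  unfold RatEven RatFunc.eval
  rw [hev, hev]
  conv_lhs => rhs; rw [← RatFunc.num_div_denom R]
  rw [div_eq_div_iff (hne (by simpa [Polynomial.comp_neg_X_eq_zero_iff] using R.denom_ne_zero))
    (hne R.denom_ne_zero), ← map_mul, ← map_mul]
  exact (RatFunc.algebraMap_injective ℂ).eq_iff

/-- The reality condition on values, as an identity between polynomials. -/
theorem num_comp_neg_X_mul_map_conj_denom (R : RatFunc ℂ)
    (hreal : ∀ ω : ℂ, ¬ IsRatPole R ω → ¬ IsRatPole R (-(starRingEnd ℂ ω)) →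
      ratValue R (-(starRingEnd ℂ ω)) = starRingEnd ℂ (ratValue R ω)) :
    R.num.comp (-Polynomial.X) * R.denom.map (starRingEnd ℂ) =
      R.num.map (starRingEnd ℂ) * R.denom.comp (-Polynomial.X) := by
  have hconj (p : Polynomial ℂ) (z : ℂ) :
      (p.map (starRingEnd ℂ)).eval z = starRingEnd ℂ (p.eval (starRingEnd ℂ z)) := by
    conv_lhs => rw [← Complex.conj_conj z]
    rw [Polynomial.eval_map_apply]
  set B := R.denom.map (starRingEnd ℂ) * R.denom.comp (-Polynomial.X) with hB
  have hB0 : B ≠ 0 := mul_ne_zero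
    ((Polynomial.map_ne_zero_iff (starRingEnd ℂ).injective).2 R.denom_ne_zero)
    (by simpa [Polynomial.comp_neg_X_eq_zero_iff] using R.denom_ne_zero)
  refine Polynomial.eq_of_infinite_eval_eq _ _
    ((Polynomial.finite_setOfPred_isRoot hB0).infinite_compl.mono fun z hz => ?_)
  have hz' : B.eval z ≠ 0 := hz
  simp only [hB, Polynomial.eval_mul, hconj, Polynomial.eval_comp, Polynomial.eval_neg,
    Polynomial.eval_X, mul_ne_zero_iff] at hz'
  have h₁ : R.denom.eval (starRingEnd ℂ z) ≠ 0 := fun h => hz'.1 (by simp [h])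
  have key := hreal (starRingEnd ℂ z) h₁ (by simpa [IsRatPole] using hz'.2)
  simp only [ratValue, RatFunc.eval, Polynomial.eval₂_id, Complex.conj_conj, map_div₀] at key
  rw [div_eq_div_iff hz'.2 hz'.1] at key
  simpa [hconj, Polynomial.eval_comp] using key

theorem ratfunc_even_of_real_poles_zeros (R : RatFunc ℂ) (hR : R ≠ 0)
    (hpoles : ∀ ω : ℂ, IsRatPole R ω → ω.im = 0)
    (hzeros : ∀ ω : ℂ, IsRatZero R ω → ω.im = 0)
    (hreal : ∀ ω : ℂ, ¬ IsRatPole R ω → ¬ IsRatPole R (-(starRingEnd ℂ ω)) →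
      ratValue R (-(starRingEnd ℂ ω)) = starRingEnd ℂ (ratValue R ω)) :
    (RatEven R ↔ Even (ratMultiplicity R 0)) ∧
      ((∃ L : ℂ, L ≠ 0 ∧ HighFrequencyLimit R L) → RatEven R) := by
  have hN0 : R.num ≠ 0 := RatFunc.num_ne_zero hR
  have hD0 : R.denom ≠ 0 := R.denom_ne_zero
  have hN := Polynomial.map_conj_of_roots_real (p := R.num) hzeros
  have hD := Polynomial.map_conj_of_roots_real (p := R.denom) hpoles
  simp only [R.monic_denom.leadingCoeff, map_one, one_mul] at hD
  have hid := num_comp_neg_X_mul_map_conj_denom R hreal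
  rw [hD] at hid
  have hc : R.num.leadingCoeff ≠ 0 := Polynomial.leadingCoeff_ne_zero.2 hN0
  have hu₁ : IsUnit (Polynomial.C R.num.leadingCoeff) := Polynomial.isUnit_C.2 hc.isUnit
  have hu₂ : IsUnit (Polynomial.C (starRingEnd ℂ R.num.leadingCoeff)) :=
    Polynomial.isUnit_C.2 (by simpa using hc)
  have hND : Polynomial.C R.num.leadingCoeff * (R.num.comp (-Polynomial.X) * R.denom) =
      Polynomial.C (starRingEnd ℂ R.num.leadingCoeff) *
        (R.num * R.denom.comp (-Polynomial.X)) := by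
    rw [hid, ← mul_assoc, hN, mul_assoc]
  have hNdvd : R.num ∣ R.num.comp (-Polynomial.X) := by
    refine R.isCoprime_num_denom.dvd_of_dvd_mul_right (hu₁.dvd_mul_left.1 ?_)
    rw [hND]
    exact ((dvd_mul_right _ _).mul_left _)
  have hDdvd : R.denom ∣ R.denom.comp (-Polynomial.X) := by
    refine R.isCoprime_num_denom.symm.dvd_of_dvd_mul_left (hu₂.dvd_mul_left.1 ?_)
    rw [← hND]
    exact ((dvd_mul_left _ _).mul_left _)
  obtain ⟨hN₁, hN₂⟩ := Polynomial.comp_neg_X_of_dvd hN0 hNdvd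
  obtain ⟨hD₁, hD₂⟩ := Polynomial.comp_neg_X_of_dvd hD0 hDdvd
  have heven : RatEven R ↔
      (-1 : ℂ) ^ R.num.rootMultiplicity 0 = (-1) ^ R.denom.rootMultiplicity 0 := by
    rw [ratEven_iff_comp_neg_X, hN₁, hD₁, mul_assoc, mul_left_comm R.num,
      mul_left_inj' (mul_ne_zero hN0 hD0), Polynomial.C_inj]
  refine ⟨?_, ?_⟩
  · rw [heven, ratMultiplicity]
    rcases Nat.even_or_odd (R.num.rootMultiplicity 0) with h₁ | h₁ <;>
      rcases Nat.even_or_odd (R.denom.rootMultiplicity 0) with h₂ | h₂ <;>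
      simp [h₁.neg_one_pow, h₂.neg_one_pow, Nat.even_add, h₁, h₂, Nat.not_even_iff_odd.2] <;>
      norm_num
  · rintro ⟨L, hL, hlim⟩
    have := Complex.cobounded_inf_principal_im_neBot 1
    have hdeg : R.num.natDegree = R.denom.natDegree :=
      Polynomial.natDegree_eq_of_tendsto_div inf_le_left hL
        ((hlim 1 one_pos).congr fun z => by simp [ratValue, RatFunc.eval, Polynomial.eval₂_id])
    rw [heven, ← hN₂, ← hD₂, hdeg]
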